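/- Let H be a finite-dimensional Hopf algebra over an algebraically closed field k of characteristic zero. Suppose there exists a decomposition H = ⨁_{i∈I} H e_i into isotypic components such that the idempotent e_𝟙 corresponding to the trivial H-module is central in H. Then H is semisimple. -/

import Mathlib

universe u

/-- `f : P →ₗ[R] M` is a projective cover of `M` if `P` is projective, `f` is surjective,
and the kernel of `f` is superfluous in `P`. -/
def IsProjectiveCover (R : Type*) [Ring R] {P M : Type*}
    [AddCommGroup P] [Module R P] [AddCommGroup M] [Module R M]
    (f : P →ₗ[R] M) : Prop :=
  Module.Projective R P ∧ Function.Surjective f ∧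
    ∀ N : Submodule R P, N ⊔ LinearMap.ker f = ⊤ → N = ⊤

section helpers
open TensorProduct Coalgebra

section derivation
variable {k H : Type*} [Field k] [Ring H] [HopfAlgebra k H]

/-- augmentation ideal -/
def augI (k H : Type*) [Field k] [Ring H] [HopfAlgebra k H] : Ideal H :=
  RingHom.ker (Bialgebra.counitAlgHom k H)

lemma mem_augI (x : H) : x ∈ augI k H ↔ counit (R := k) x = 0 := by
  simp [augI, RingHom.mem_ker]

instance : (augI k H).IsTwoSided := by unfold augI; infer_instance

/-- the map `a ⊗ b ↦ d b • a` -/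
noncomputable def contr (d : H →ₗ[k] k) : H ⊗[k] H →ₗ[k] H :=
  (TensorProduct.rid k H).toLinearMap ∘ₗ d.lTensor H

@[simp] lemma contr_tmul (d : H →ₗ[k] k) (a b : H) : contr d (a ⊗ₜ b) = d b • a := by
  simp [contr]

lemma contr_counit (a : H) : contr (counit (R := k)) (comul a) = a := by
  simp [contr]

lemma contr_mul (d : H →ₗ[k] k)
    (hd : ∀ a b, d (a * b) = counit (R := k) a * d b + d a * counit (R := k) b)
    (t u : H ⊗[k] H) :
    contr d (t * u) = contr (counit (R := k)) t * contr d u +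
      contr d t * contr (counit (R := k)) u := by
  induction t with
  | zero => simp
  | add x y hx hy => simp only [add_mul, map_add, hx, hy]; abel
  | tmul a b =>
    induction u with
    | zero => simp
    | add x y hx hy => simp only [mul_add, map_add, hx, hy]; abel
    | tmul c e =>
      simp [hd, add_smul, smul_smul, mul_comm]

/-- derivation attached to `d` -/
noncomputable def der (d : H →ₗ[k] k) : H →ₗ[k] H := contr d ∘ₗ comul

lemma der_mul (d : H →ₗ[k] k)
    (hd : ∀ a b, d (a * b) = counit (R := k) a * d b + d a * counit (R := k) b) (a b : H) :
    der d (a * b) = a * der d b + der d a * b := by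
  simp [der, contr_mul d hd, contr_counit]

lemma counit_der (d : H →ₗ[k] k) (a : H) : counit (R := k) (der d a) = d a := by
  have : ∀ t : H ⊗[k] H, counit (R := k) (contr d t) =
      d (TensorProduct.lid k H ((counit (R := k)).rTensor H t)) := by
    intro t
    induction t with
    | zero => simp
    | add x y hx hy => simp only [map_add, hx, hy]
    | tmul a b => simp [mul_comm]
  simp [der, this]

lemma der_pow_mem (d : H →ₗ[k] k)
    (hd : ∀ a b, d (a * b) = counit (R := k) a * d b + d a * counit (R := k) b) (m : ℕ) :
    ∀ y ∈ (augI k H) ^ (m + 1), der d y ∈ (augI k H) ^ m := by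
  induction m with
  | zero => intro y _; rw [Submodule.pow_zero, Ideal.one_eq_top]; trivial
  | succ m ih =>
    intro y hy
    rw [Submodule.pow_succ] at hy
    refine Submodule.mul_induction_on hy ?_ ?_
    · intro a ha b hb
      rw [der_mul d hd]
      refine add_mem ?_ ?_
      · exact Ideal.mul_mem_right _ _ ha
      · rw [Submodule.pow_succ]
        exact Ideal.mul_mem_mul (ih a ha) hb
    · intro a b ha hb
      rw [map_add]; exact add_mem ha hb

lemma der_x_pow (d : H →ₗ[k] k)
    (hd : ∀ a b, d (a * b) = counit (R := k) a * d b + d a * counit (R := k) b)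
    (x : H) (hx : x ∈ augI k H) (hdx : d x = 1) (m : ℕ) :
    der d (x ^ (m + 1)) - ((m + 1 : ℕ) : k) • x ^ m ∈ (augI k H) ^ (m + 1) := by
  have h1 : der d x - 1 ∈ augI k H := by
    rw [mem_augI, map_sub, counit_der, hdx]; simp
  induction m with
  | zero => rw [zero_add, Submodule.pow_one]; simpa using h1
  | succ m ih =>
    have e1 : der d (x ^ (m + 1 + 1)) - ((m + 1 + 1 : ℕ) : k) • x ^ (m + 1) =
        x ^ (m + 1) * (der d x - 1) +
          (der d (x ^ (m + 1)) - ((m + 1 : ℕ) : k) • x ^ m) * x := by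
      rw [pow_succ x (m + 1), der_mul d hd, mul_sub, sub_mul, smul_mul_assoc, ← pow_succ]
      push_cast
      simp only [add_smul, one_smul, mul_one]
      abel
    rw [e1, Submodule.pow_succ (n := m + 1)]
    exact add_mem (Ideal.mul_mem_mul (Ideal.pow_mem_pow hx _) h1) (Ideal.mul_mem_mul ih hx)

lemma augI_sq [CharZero k] [FiniteDimensional k H] : augI k H * augI k H = augI k H := by
  by_contra hne
  have hlt : ∃ x ∈ augI k H, x ∉ augI k H * augI k H := by
    by_contra hcon
    push Not at hcon
    exact hne (le_antisymm Ideal.mul_le_left hcon)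
  obtain ⟨x, hx, hx2⟩ := hlt
  -- functional
  let W : Submodule k H := ((augI k H * augI k H).restrictScalars k) ⊔ Submodule.span k {1}
  have hxW : x ∉ W := by
    intro hmem
    obtain ⟨y, hy, z, hz, hyz⟩ := Submodule.mem_sup.1 hmem
    obtain ⟨c, rfl⟩ := Submodule.mem_span_singleton.1 hz
    have hy' : y ∈ augI k H * augI k H := hy
    have hy0 := (mem_augI (k := k) y).1 (Ideal.mul_le_left hy')
    have hx0 := (mem_augI (k := k) x).1 hx
    have : c = 0 := by
      rw [← hyz] at hx0
      simpa [hy0] using hx0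
    subst this
    simp at hyz
    exact hx2 (hyz ▸ hy')
  obtain ⟨d, hd1, hdW⟩ := Submodule.exists_le_ker_of_notMem hxW
  obtain ⟨d, hdx, hd1, hdJ⟩ : ∃ d : H →ₗ[k] k, d x = 1 ∧ d 1 = 0 ∧
      ∀ y ∈ augI k H * augI k H, d y = 0 := by
    refine ⟨(d x)⁻¹ • d, by simp [hd1], ?_, ?_⟩
    · have : d 1 = 0 := hdW (Submodule.mem_sup_right (Submodule.mem_span_singleton_self _))
      simp [this]
    · intro y hy
      have : d y = 0 := hdW (Submodule.mem_sup_left hy)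
      simp [this]
  have hd : ∀ a b, d (a * b) = counit (R := k) a * d b + d a * counit (R := k) b := by
    intro a b
    have h1 : ∀ a : H, a - counit (R := k) a • 1 ∈ augI k H := by
      intro a; rw [mem_augI]; simp
    have := hdJ _ (Ideal.mul_mem_mul (h1 a) (h1 b))
    simp only [mul_sub, sub_mul, map_sub, smul_mul_assoc, mul_smul_comm, one_mul, mul_one,
      map_smul, smul_eq_mul, hd1, mul_zero, sub_zero] at this
    linear_combination this
  have : IsArtinianRing H := IsArtinianRing.of_finite k H
  obtain ⟨n, hn⟩ := IsArtinian.monotone_stabilizes (R := H) (M := H)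
    ⟨fun n => OrderDual.toDual ((augI k H) ^ n), fun a b hab => Ideal.pow_le_pow_right hab⟩
  have hn1 : (augI k H) ^ n = (augI k H) ^ (n + 1) := hn (n + 1) (Nat.le_succ n)
  have key : ∀ m, x ^ m ∉ (augI k H) ^ (m + 1) := by
    intro m
    induction m with
    | zero =>
      rw [zero_add, Submodule.pow_one, pow_zero, mem_augI]; simp
    | succ m ih =>
      intro h
      apply ih
      have h1 := der_pow_mem d hd _ _ h
      have h2 := der_x_pow d hd x hx hdx m
      have h3 := sub_mem h1 h2
      rw [sub_sub_cancel] at h3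
      have h4 := Submodule.smul_of_tower_mem _ (((m + 1 : ℕ) : k)⁻¹) h3
      rwa [smul_smul, inv_mul_cancel₀ (Nat.cast_ne_zero.2 (Nat.succ_ne_zero m)), one_smul] at h4
  exact key n (hn1 ▸ Ideal.pow_mem_pow hx n)

end derivation

section maschke
variable {k H : Type*} [Field k] [Ring H] [HopfAlgebra k H]

/-- `e₁ ⊗ S(e₂)` -/
noncomputable def casi (k : Type*) {H : Type*} [Field k] [Ring H] [HopfAlgebra k H] (e : H) :
    H ⊗[k] H :=
  (HopfAlgebra.antipode k).lTensor H (comul e)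

/-- `p ⊗ q ↦ (p ⊗ 1) c (1 ⊗ q)` -/
noncomputable def sand (c : H ⊗[k] H) : H ⊗[k] H →ₗ[k] H ⊗[k] H :=
  TensorProduct.lift (LinearMap.mk₂ k (fun p q => (p ⊗ₜ[k] (1 : H)) * c * ((1 : H) ⊗ₜ[k] q))
    (by intros; simp [TensorProduct.add_tmul, add_mul])
    (by intros; simp [← TensorProduct.smul_tmul'])
    (by intros; simp [TensorProduct.tmul_add, mul_add])
    (by intros; simp))

@[simp] lemma sand_tmul (c : H ⊗[k] H) (p q : H) :
    sand c (p ⊗ₜ q) = (p ⊗ₜ[k] (1 : H)) * c * ((1 : H) ⊗ₜ[k] q) := by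
  simp [sand]

lemma casi_comm (e : H) (he : ∀ h : H, h * e = counit (R := k) h • e) (h : H) :
    (h ⊗ₜ[k] (1 : H)) * casi k e = casi k e * ((1 : H) ⊗ₜ[k] h) := by
  let c := casi k e
  -- the antipode is an antihomomorphism
  have anti : ∀ (t u : H ⊗[k] H) (b : H),
      (HopfAlgebra.antipode k).lTensor H (t * u) * ((1 : H) ⊗ₜ[k] b) =
      sand ((HopfAlgebra.antipode k).lTensor H u)
        ((LinearMap.mul' k H ∘ₗ (HopfAlgebra.antipode k).rTensor H).lTensor H
          (TensorProduct.assoc k H H H (t ⊗ₜ b))) := by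
    intro t u b
    induction t with
    | zero => simp
    | add x y hx hy => simp only [add_mul, map_add, hx, hy, TensorProduct.add_tmul]
    | tmul p q =>
      induction u with
      | zero => simp
      | add x y hx hy =>
        simp only [mul_add, add_mul, map_add, hx, hy, sand_tmul, TensorProduct.assoc_tmul,
          LinearMap.lTensor_tmul]
      | tmul r s =>
        simp [HopfAlgebra.antipode_mul_antidistrib, mul_assoc]
  have e1 : ∀ t : H ⊗[k] H,
      sand c ((LinearMap.mul' k H ∘ₗ (HopfAlgebra.antipode k).rTensor H).lTensor H
          (TensorProduct.assoc k H H H (comul.rTensor H t))) =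
      c * ((1 : H) ⊗ₜ[k] (TensorProduct.lid k H ((counit (R := k)).rTensor H t))) := by
    intro t
    induction t with
    | zero => simp
    | add x y hx hy => simp only [map_add, hx, hy, TensorProduct.tmul_add, mul_add]
    | tmul a b =>
      have h1 := anti (comul a) (comul e) b
      rw [← Bialgebra.comul_mul, he] at h1
      simp only [LinearMap.rTensor_tmul]
      change _ = sand c _ at h1
      rw [← h1]
      simp [c, casi]
  have h2 := e1 (comul h)
  rw [Coalgebra.coassoc_apply] at h2
  have h3 : (LinearMap.mul' k H ∘ₗ (HopfAlgebra.antipode k).rTensor H) ∘ₗ comul =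
      (Algebra.linearMap k H) ∘ₗ counit := HopfAlgebra.mul_antipode_rTensor_comul
  rw [← LinearMap.lTensor_comp_apply, h3, LinearMap.lTensor_comp_apply] at h2
  simpa [c, ← Algebra.TensorProduct.one_def] using h2

theorem maschke_hopf (e : H) (he : ∀ h : H, h * e = counit (R := k) h • e)
    (he1 : counit (R := k) e = 1) : IsSemisimpleRing H := by
  have : ComplementedLattice (Submodule H H) := by
    constructor
    intro N
    obtain ⟨π, hπ⟩ := (N.restrictScalars k).subtype.exists_leftInverse_of_injective
      (Submodule.ker_subtype _)
    let g : H →ₗ[k] H := (N.restrictScalars k).subtype ∘ₗ π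
    have hgN : ∀ x, g x ∈ N := fun x => (π x).2
    have hg : ∀ x ∈ N, g x = x := fun x hx => 
      congrArg Subtype.val (LinearMap.congr_fun hπ ⟨x, hx⟩)
    let F : H → H ⊗[k] H →ₗ[k] H := fun m =>
      LinearMap.mul' k H ∘ₗ (g ∘ₗ LinearMap.mulRight k m).lTensor H
    have F1 : ∀ m a b, F m (a ⊗ₜ b) = a * g (b * m) := by intros; simp [F]
    have Fr : ∀ h m t, F m (t * ((1 : H) ⊗ₜ[k] h)) = F (h * m) t := by
      intro h m t
      induction t with
      | zero => simp
      | add x y hx hy => simp only [add_mul, map_add, hx, hy]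
      | tmul a b => simp [F1, mul_assoc]
    have Fl : ∀ h m t, F m ((h ⊗ₜ[k] (1 : H)) * t) = h * F m t := by
      intro h m t
      induction t with
      | zero => simp
      | add x y hx hy => simp only [mul_add, map_add, hx, hy]
      | tmul a b => simp [F1, mul_assoc]
    have Fa : ∀ m n t, F (m + n) t = F m t + F n t := by
      intro m n t
      induction t with
      | zero => simp
      | add x y hx hy => simp only [map_add, hx, hy]; abel
      | tmul a b => simp [F1, mul_add]
    have FN : ∀ m t, F m t ∈ N := by
      intro m t
      induction t with
      | zero => simp
      | add x y hx hy => rw [map_add]; exact add_mem hx hy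
      | tmul a b => rw [F1]; exact N.smul_mem a (hgN _)
    have Fid : ∀ m ∈ N, ∀ t, F m t = LinearMap.mul' k H t * m := by
      intro m hm t
      induction t with
      | zero => simp
      | add x y hx hy => simp only [map_add, hx, hy, add_mul]
      | tmul a b => rw [F1, hg (b * m) (N.smul_mem b hm)]; simp [mul_assoc]
    let p : H →ₗ[H] N :=
      { toFun := fun m => ⟨F m (casi k e), FN _ _⟩
        map_add' := fun m n => Subtype.ext (Fa m n _)
        map_smul' := fun h m => Subtype.ext (by
          simp only [smul_eq_mul, RingHom.id_apply, Submodule.coe_smul]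
          rw [← Fr, ← casi_comm e he, Fl]) }
    refine ⟨LinearMap.ker p, LinearMap.isCompl_of_proj (f := p) ?_⟩
    intro x
    apply Subtype.ext
    change F x (casi k e) = x
    rw [Fid _ x.2, casi, HopfAlgebra.mul_antipode_lTensor_comul_apply, he1]
    simp
  exact (isSemisimpleModule_iff H H).2 inferInstance

end maschke

end helpers

/-- Let `H` be a finite-dimensional Hopf algebra over an algebraically
closed field `k` of characteristic zero.  Suppose `H = ⨁_{i ∈ I} H·(e i)` is an isotypic
decomposition (indexed by a complete irredundant family `S i` of simple `H`-modules,
with `H·(e i)` isomorphic to `P i ^{⊕ dim S i}` for projective covers `P i` of `S i`,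
and `e i` orthogonal idempotents summing to `1`) such that the idempotent `e i₀`
corresponding to the trivial `H`-module (the module `k` with `H`-action through the
counit `ε`) is central in `H`.  Then `H` is semisimple. -/
theorem stmt8 {k : Type u} {H : Type u} [Field k] [IsAlgClosed k] [CharZero k]
    [Ring H] [HopfAlgebra k H] [FiniteDimensional k H]
    {I : Type u} [Fintype I] [DecidableEq I]
    (S : I → Type u) [∀ i, AddCommGroup (S i)] [∀ i, Module H (S i)]
    [∀ i, Module k (S i)] [∀ i, IsScalarTower k H (S i)]
    (hS : ∀ i, IsSimpleModule H (S i))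
    (hpairwise : ∀ i j, i ≠ j → IsEmpty (S i ≃ₗ[H] S j))
    (hcomplete : ∀ (M : Type u) [AddCommGroup M] [Module H M],
      IsSimpleModule H M → ∃ i, Nonempty (M ≃ₗ[H] S i))
    (P : I → Type u) [∀ i, AddCommGroup (P i)] [∀ i, Module H (P i)]
    (f : ∀ i, P i →ₗ[H] S i) (hcover : ∀ i, IsProjectiveCover H (f i))
    (e : I → H)
    (hidem : ∀ i, e i * e i = e i)
    (horth : ∀ i j, i ≠ j → e i * e j = 0)
    (hsum : ∑ i, e i = 1)
    (hiso : ∀ i, Nonempty (↥(Submodule.span H ({e i} : Set H)) ≃ₗ[H]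
      (Fin (Module.finrank k (S i)) → P i)))
    (i₀ : I)
    (triv : S i₀ ≃ₗ[k] k)
    (htriv : ∀ (h : H) (x : S i₀), triv (h • x) = Coalgebra.counit (R := k) h * triv x)
    (hcentral : ∀ h : H, e i₀ * h = h * e i₀) :
    IsSemisimpleRing H := by
  have hdim : Module.finrank k (S i₀) = 1 := by rw [triv.finrank_eq, Module.finrank_self]
  obtain ⟨iso⟩ := hiso i₀
  obtain ⟨-, hsurj, hsup⟩ := hcover i₀
  let E : H := e i₀
  let ev : (Fin (Module.finrank k (S i₀)) → P i₀) ≃ₗ[H] P i₀ :=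
    (LinearEquiv.funCongrLeft H (P i₀) (finCongr hdim.symm)).trans
      (LinearEquiv.funUnique (Fin 1) H (P i₀))
  let ψ : ↥(Submodule.span H ({e i₀} : Set H)) ≃ₗ[H] P i₀ := iso.trans ev
  -- the distinguished generator
  let e' : ↥(Submodule.span H ({e i₀} : Set H)) := ⟨e i₀, Submodule.mem_span_singleton_self _⟩
  have hgen : ∀ x : ↥(Submodule.span H ({e i₀} : Set H)), ∃ h : H, x = h • e' := by
    intro x
    obtain ⟨h, hh⟩ := Submodule.mem_span_singleton.1 x.2
    exact ⟨h, Subtype.ext hh.symm⟩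
  let t : S i₀ := f i₀ (ψ e')
  have ht : ∀ h : H, triv (f i₀ (ψ (h • e'))) = Coalgebra.counit (R := k) h * triv t := by
    intro h
    rw [map_smul, map_smul, htriv]
  have htne : triv t ≠ 0 := by
    intro h0
    obtain ⟨p, hp⟩ := hsurj (triv.symm 1)
    obtain ⟨h, hh⟩ := hgen (ψ.symm p)
    have h1 := ht h
    rw [← hh, LinearEquiv.apply_symm_apply, hp, h0] at h1
    simp at h1
  have hee : e i₀ • e' = e' := Subtype.ext (hidem i₀)
  have hcounit : Coalgebra.counit (R := k) (e i₀) = 1 := by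
    have h1 := ht (e i₀)
    rw [hee] at h1
    exact (mul_right_cancel₀ htne (by rw [one_mul]; exact h1)).symm
  -- `J e` is contained in the Jacobson radical
  have hjac : ∀ y ∈ augI k H, y * e i₀ ∈ Ring.jacobson H := by
    intro y hy
    rw [Ring.jacobson_eq_sInf_isMaximal, Submodule.mem_sInf]
    intro m hm
    have hm : Ideal.IsMaximal m := hm
    by_contra hnot
    have htop : m ⊔ Ideal.span {y * e i₀} = ⊤ := by
      refine hm.1.2 _ (lt_of_le_of_ne le_sup_left ?_)
      intro h
      apply hnot
      rw [h]
      exact Submodule.mem_sup_right (Submodule.mem_span_singleton_self _)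
    obtain ⟨u, hu, v, hv, huv⟩ := Submodule.mem_sup.1 (htop ▸ Submodule.mem_top : e i₀ ∈ _)
    obtain ⟨z, rfl⟩ := Submodule.mem_span_singleton.1 hv
    -- `u = e - z y e`
    let w : ↥(Submodule.span H ({e i₀} : Set H)) := e' - (z * y) • e'
    have hw : (w : H) = u := by
      change e i₀ - (z * y) * e i₀ = u
      rw [sub_eq_iff_eq_add, mul_assoc]
      exact huv.symm
    have hzy : (z * y) • e' ∈ LinearMap.ker ((f i₀) ∘ₗ ψ.toLinearMap) := by
      rw [LinearMap.mem_ker]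
      apply triv.injective
      have h1 := ht (z * y)
      rw [Bialgebra.counit_mul, (mem_augI y).1 hy, mul_zero, zero_mul] at h1
      rw [map_zero]
      exact h1
    have hN := hsup ((Submodule.span H {w}).map ψ.toLinearMap) (by
      rw [eq_top_iff]
      intro p _
      obtain ⟨h, hh⟩ := hgen (ψ.symm p)
      have hp : p = ψ (h • w) + ψ (h • ((z * y) • e')) := by
        rw [← map_add, ← smul_add, sub_add_cancel, ← hh, LinearEquiv.apply_symm_apply]
      rw [hp]
      refine Submodule.add_mem_sup ?_ ?_
      · exact Submodule.mem_map_of_mem (Submodule.smul_mem _ _ (Submodule.mem_span_singleton_self _))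
      · exact (LinearMap.ker ((f i₀) ∘ₗ ψ.toLinearMap)).smul_mem h hzy)
    have he' : ψ e' ∈ (Submodule.span H {w}).map ψ.toLinearMap := hN ▸ Submodule.mem_top
    obtain ⟨q, hq, hqe⟩ := he'
    have hqe' : q = e' := ψ.injective hqe
    obtain ⟨h, rfl⟩ := Submodule.mem_span_singleton.1 hq
    have hem : e i₀ ∈ m := by
      have h1 : h * (w : H) = e i₀ := congrArg Subtype.val hqe'
      rw [← h1, hw]
      exact Ideal.mul_mem_left m h hu
    exact hnot (Ideal.mul_mem_left m y hem)
  have hpow : ∀ n : ℕ, ∀ y ∈ augI k H, y * e i₀ ∈ (Ring.jacobson H) ^ n := by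
    intro n
    induction n with
    | zero => intro y _; rw [Submodule.pow_zero, Ideal.one_eq_top]; trivial
    | succ n ih =>
      intro y hy
      rw [← augI_sq] at hy
      refine Submodule.mul_induction_on hy ?_ ?_
      · intro a ha b hb
        have h1 : a * b * e i₀ = (a * e i₀) * (b * e i₀) := by
          rw [mul_assoc a (e i₀), ← mul_assoc (e i₀) b, hcentral b, mul_assoc b, hidem, mul_assoc]
        rw [h1, Submodule.pow_succ]
        exact Ideal.mul_mem_mul (ih a ha) (hjac b hb)
      · intro a b ha hb
        rw [add_mul]; exact add_mem ha hb
  have hart : IsArtinianRing H := IsArtinianRing.of_finite k H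
  obtain ⟨n, hn⟩ := IsSemiprimaryRing.isNilpotent (R := H)
  have hJe : ∀ y ∈ augI k H, y * e i₀ = 0 := by
    intro y hy
    have h1 := hpow n y hy
    rw [hn] at h1
    exact h1
  refine maschke_hopf (k := k) (e i₀) ?_ hcounit
  intro h
  have h1 := hJe (h - Coalgebra.counit (R := k) h • 1) (by rw [mem_augI]; simp)
  rw [sub_mul, smul_mul_assoc, one_mul, sub_eq_zero] at h1
  exact h1
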